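/- arXiv:1108.0404 — 2 statements merged into one kernel-verified Lean document; each statement's English description precedes it below -/
import Mathlib

section
/- Agent-and-type independence of the value function in a collaborative graphical Bayesian game: if two joint policies β and β' agree except possibly in the action agent i selects for a single type θ̂_i ∈ Θ_i, then V(β') − V(β) = Σ_{e∈E : i∈e} Σ_{θ_e∈Θ_e : (θ_e)_i = θ̂_i} ( C^e_{θ_e}(β'_e(θ_e)) − C^e_{θ_e}(β_e(θ_e)) ), where C^e_{θ_e}(a_e) = Pr(θ_e) u^e(θ_e, a_e) is the local contribution. In particular, the action selected for type θ̂_i affects only contributions of edges containing agent i whose local joint type specifies θ̂_i for agent i. -/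
open Finset

open scoped Classical in
/-- The sum of a weighted function factoring through `r` is the sum of that function against the
pushforward of the weights along `r`. -/
theorem sum_mul_comp_eq_sum_fiber_mul {α β : Type*} [Fintype α] [Fintype β]
    (r : α → β) (p : α → ℝ) (f : β → ℝ) :
    ∑ a, p a * f (r a) = ∑ b, (∑ a ∈ univ.filter (fun a => r a = b), p a) * f b := by
  rw [← Finset.sum_fiberwise univ r]
  refine Finset.sum_congr rfl fun b _ => ?_
  rw [Finset.sum_mul]
  refine Finset.sum_congr rfl fun a ha => ?_
  rw [(Finset.mem_filter.mp ha).2]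

open scoped Classical in
/-- Agent-and-type independence of the value function in a collaborative graphical
Bayesian game: if two joint policies agree except possibly in the action agent `i`
selects for a single type `θhat`, then the value difference is the sum over edges
containing `i`, and over local joint types specifying `θhat` for agent `i`, of the
differences of local contributions `C^e_{θe}(a_e) = Pr(θe) · u^e(θe, a_e)`. -/
theorem cgbg_agent_and_type_independence
    {N : Type} [Fintype N] [Nonempty N] [DecidableEq N]
    {A : N → Type} [∀ i, Fintype (A i)] [∀ i, Nonempty (A i)]
    {Θ : N → Type} [∀ i, Fintype (Θ i)] [∀ i, Nonempty (Θ i)]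
    {E : Type} [Fintype E]
    (scope : E → Finset N)
    (hscope : ∀ e, (scope e).Nonempty)
    (p : (∀ i, Θ i) → ℝ)
    (hp : ∀ θ, 0 ≤ p θ) (hpsum : ∑ θ : ∀ i, Θ i, p θ = 1)
    (u : (∀ i, Θ i) → (∀ i, A i) → ℝ)
    (uloc : (e : E) → ((i : scope e) → Θ i) → ((i : scope e) → A i) → ℝ)
    (hdecomp : ∀ (θ : ∀ i, Θ i) (a : ∀ i, A i),
      u θ a = ∑ e : E, uloc e (fun i => θ i) (fun i => a i))
    (V : (∀ i, Θ i → A i) → ℝ)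
    (hV : ∀ β : ∀ i, Θ i → A i,
      V β = ∑ θ : ∀ i, Θ i, p θ * u θ (fun i => β i (θ i)))
    (pE : (e : E) → ((i : scope e) → Θ i) → ℝ)
    (hpE : ∀ (e : E) (θe : (i : scope e) → Θ i),
      pE e θe = ∑ θ' ∈ Finset.univ.filter
        (fun θ' : ∀ i, Θ i => ∀ i : scope e, θ' i = θe i), p θ')
    (i : N) (θhat : Θ i)
    (β β' : ∀ i, Θ i → A i)
    (hagree_agents : ∀ j, j ≠ i → β j = β' j)
    (hagree_types : ∀ θi : Θ i, θi ≠ θhat → β i θi = β' i θi) :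
    V β' - V β =
      ∑ e : E, (if h : i ∈ scope e then
        ∑ θe ∈ Finset.univ.filter
            (fun θe : (j : scope e) → Θ j => θe ⟨i, h⟩ = θhat),
          (pE e θe * uloc e θe (fun j => β' j (θe j)) -
            pE e θe * uloc e θe (fun j => β j (θe j)))
      else 0) := by
  have hlocal : ∀ γ : ∀ i, Θ i → A i, V γ =
      ∑ e : E, ∑ θe : (j : scope e) → Θ j, pE e θe * uloc e θe (fun j => γ j (θe j)) := by
    intro γ
    simp only [hV, hdecomp, Finset.mul_sum]
    rw [Finset.sum_comm]
    refine Finset.sum_congr rfl fun e _ => ?_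
    rw [sum_mul_comp_eq_sum_fiber_mul (fun (θ : ∀ i, Θ i) (j : scope e) => θ j) p
      (fun θe => uloc e θe (fun j => γ j (θe j)))]
    refine Finset.sum_congr rfl fun θe _ => ?_
    rw [hpE]
    congr 1
    refine Finset.sum_congr ?_ fun _ _ => rfl
    ext θ
    simp [funext_iff]
  have hagree : ∀ (j : N) (t : Θ j), (∀ h : j = i, h ▸ t ≠ θhat) → β' j t = β j t := by
    intro j t h
    by_cases hj : j = i
    · subst hj
      exact (hagree_types t (h rfl)).symm
    · rw [hagree_agents j hj]
  rw [hlocal, hlocal, ← Finset.sum_sub_distrib]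
  refine Finset.sum_congr rfl fun e _ => ?_
  rw [← Finset.sum_sub_distrib]
  split_ifs with h
  · symm
    refine Finset.sum_subset (Finset.filter_subset _ _) fun θe _ hθe => ?_
    have hne : θe ⟨i, h⟩ ≠ θhat := by simpa using hθe
    have hact : (fun j : scope e => β' j (θe j)) =
        fun j : scope e => β j (θe j) := by
      funext ⟨j, hj⟩
      refine hagree j _ ?_
      rintro rfl
      exact hne
    rw [hact, sub_self]
  · refine Finset.sum_eq_zero fun θe _ => ?_
    have hact : (fun j : scope e => β' j (θe j)) =
        fun j : scope e => β j (θe j) := by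
      funext ⟨j, hj⟩
      exact hagree j _ fun hji => absurd (hji ▸ hj) h
    rw [hact, sub_self]
end

section
/- In a finite collaborative Bayesian game, a joint policy maximizes the value V over all joint policies if and only if it maximizes the sum-of-local-contributions objective: β* = argmax_β V(β) if and only if β* = argmax_β Σ_{e∈E} Σ_{θ_e∈Θ_e} C^e_{θ_e}(β_e(θ_e)), whenever the common payoff decomposes as u(θ, a) = Σ_{e∈E} u^e(θ_e, a_e). -/
open Finset

/-- Summing `g` against the push-forward along `f` of the weights `p` equals summing `g ∘ f`
against `p`. -/
theorem Finset.sum_fiber_sum_mul {α β R : Type*} [Fintype α] [Fintype β] [DecidableEq β]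
    [NonUnitalNonAssocSemiring R] (f : α → β) (p : α → R) (g : β → R) :
    ∑ y, (∑ x with f x = y, p x) * g y = ∑ x, p x * g (f x) := by
  rw [← Finset.sum_fiberwise Finset.univ f]
  refine Finset.sum_congr rfl fun y _ => ?_
  rw [Finset.sum_mul]
  refine Finset.sum_congr rfl fun x hx => ?_
  rw [(Finset.mem_filter.mp hx).2]

open scoped Classical in
/-- In a finite collaborative (graphical) Bayesian game whose common payoff decomposes
over edges, a joint policy maximizes the value `V` over all joint policies if and only
if it maximizes the sum-of-local-contributions objective. -/
theorem cgbg_maximizer_iff_maximizes_local_contributions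
    {N : Type} [Fintype N] [Nonempty N] [DecidableEq N]
    {A : N → Type} [∀ i, Fintype (A i)] [∀ i, Nonempty (A i)]
    {Θ : N → Type} [∀ i, Fintype (Θ i)] [∀ i, Nonempty (Θ i)]
    {E : Type} [Fintype E]
    (scope : E → Finset N)
    (hscope : ∀ e, (scope e).Nonempty)
    (p : (∀ i, Θ i) → ℝ)
    (hp : ∀ θ, 0 ≤ p θ) (hpsum : ∑ θ : ∀ i, Θ i, p θ = 1)
    (u : (∀ i, Θ i) → (∀ i, A i) → ℝ)
    (uloc : (e : E) → ((i : scope e) → Θ i) → ((i : scope e) → A i) → ℝ)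
    (hdecomp : ∀ (θ : ∀ i, Θ i) (a : ∀ i, A i),
      u θ a = ∑ e : E, uloc e (fun i => θ i) (fun i => a i))
    (V : (∀ i, Θ i → A i) → ℝ)
    (hV : ∀ β : ∀ i, Θ i → A i,
      V β = ∑ θ : ∀ i, Θ i, p θ * u θ (fun i => β i (θ i)))
    (pE : (e : E) → ((i : scope e) → Θ i) → ℝ)
    (hpE : ∀ (e : E) (θe : (i : scope e) → Θ i),
      pE e θe = ∑ θ' ∈ Finset.univ.filter
        (fun θ' : ∀ i, Θ i => ∀ i : scope e, θ' i = θe i), p θ')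
    (G : (∀ i, Θ i → A i) → ℝ)
    (hG : ∀ β : ∀ i, Θ i → A i,
      G β = ∑ e : E, ∑ θe : (i : scope e) → Θ i,
        pE e θe * uloc e θe (fun i => β i (θe i)))
    (βstar : ∀ i, Θ i → A i) :
    (∀ β : ∀ i, Θ i → A i, V βstar ≥ V β) ↔
      (∀ β : ∀ i, Θ i → A i, G βstar ≥ G β) := by
  have hVG : V = G := by
    funext β
    rw [hV, hG]
    simp_rw [hdecomp, Finset.mul_sum]
    rw [Finset.sum_comm]
    refine Finset.sum_congr rfl fun e _ => ?_
    rw [← Finset.sum_fiber_sum_mul (fun (θ : ∀ i, Θ i) (i : scope e) => θ i) p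
      fun θe => uloc e θe fun i => β i (θe i)]
    simp_rw [hpE, funext_iff]
  rw [hVG]
end
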